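/- arXiv:1408.0757 — 2 statements merged into one kernel-verified Lean document; each statement's English description precedes it below -/
import Mathlib

section
/- Let ℓ > 0 satisfy √3·ℓ < 2^{-1/6}, let 0 < a ≤ (√3/2)ℓ, and set Ω = (⌈4/ℓ⌉ + 1)³, D₁ = (23/32)/(2Ω) · [V_a((√6/2)ℓ) + V_a(√3·ℓ)] − 1 and D₂ = (23/32)/(4Ω) · [V_a((√3/2)ℓ) + 3·V_a((3/2)ℓ)] − 1. Assume D₁ > 0 and D₂ > 0. Then for every N ≥ 2 and every minimum-energy configuration (x*_1,…,x*_N) for V_a, one has W⁺_a(x*) ≤ max{ V_a((√6/2)ℓ)/D₁ , V_a((√3/2)ℓ)/D₂ }. -/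
open MeasureTheory Real

noncomputable section

abbrev E3 := EuclideanSpace ℝ (Fin 3)

/-- Lennard-Jones potential -/
def VLJ (r : ℝ) : ℝ := 1 / r ^ 12 - 2 / r ^ 6

/-- cut-off Lennard-Jones potential -/
def Va (a r : ℝ) : ℝ := if a < r then VLJ r else VLJ a

/-- configurational energy of N particles -/
def pairEnergy (V : ℝ → ℝ) {N : ℕ} (x : Fin N → E3) : ℝ :=
  ∑ p ∈ Finset.univ.filter (fun p : Fin N × Fin N => p.1 < p.2), V ‖x p.1 - x p.2‖

/-- stability with constant B -/
def IsStableWith (V : ℝ → ℝ) (B : ℝ) : Prop :=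
  0 ≤ B ∧ ∀ (N : ℕ) (x : Fin N → E3), -(B * N) ≤ pairEnergy V x

/-- stability constant: infimum of admissible stability constants -/
def stabConst (V : ℝ → ℝ) : ℝ := sInf {B | IsStableWith V B}

def IsMinEnergy (V : ℝ → ℝ) {N : ℕ} (x : Fin N → E3) : Prop :=
  ∀ y : Fin N → E3, pairEnergy V x ≤ pairEnergy V y

def IsTempered (V : ℝ → ℝ) : Prop :=
  ∃ r₀ : ℝ, 0 ≤ r₀ ∧ IntegrableOn (fun x : E3 => |V ‖x‖|) {x | r₀ ≤ ‖x‖}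

open scoped Classical in
/-- n-th Mayer coefficient -/
def mayerCoeff (V : ℝ → ℝ) (β : ℝ) (Λ : Set E3) (n : ℕ) : ℝ :=
  (volume Λ).toReal⁻¹ * (n.factorial : ℝ)⁻¹ *
    ∫ x : Fin n → E3 in Set.univ.pi fun _ => Λ,
      ∑ g ∈ Finset.univ.filter (fun g : SimpleGraph (Fin n) => g.Connected),
        ∏ e ∈ Finset.univ.filter (fun e : Sym2 (Fin n) => e ∈ g.edgeSet),
          Sym2.lift ⟨fun i j => Real.exp (-β * V ‖x i - x j‖) - 1,
            fun i j => by simp only [norm_sub_rev (x i)]⟩ e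

/-- positive part of the interaction of particle `i` with the others:
sum over the particles at distance `< 2^{-1/6}` from particle `i` -/
def Wplus (a : ℝ) {N : ℕ} (x : Fin N → E3) (i : Fin N) : ℝ :=
  ∑ j ∈ Finset.univ.filter
      (fun j : Fin N => j ≠ i ∧ ‖x i - x j‖ < (2 : ℝ) ^ (-(1 : ℝ) / 6)),
    Va a ‖x i - x j‖

/-- maximal positive interaction `W⁺_a(x) = max_i W⁺_a(i,x)` -/
def WplusMax (a : ℝ) {N : ℕ} (x : Fin N → E3) : ℝ :=
  sSup {w : ℝ | ∃ i : Fin N, w = Wplus a x i}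

/-! ### The cut-off potential -/

lemma Va_eq_VLJ_max (a r : ℝ) : Va a r = VLJ (max a r) := by
  unfold Va
  split_ifs with h
  · rw [max_eq_right h.le]
  · rw [max_eq_left (not_lt.mp h)]

lemma VLJ_eq_sq (r : ℝ) : VLJ r = (1 / r ^ 6 - 1) ^ 2 - 1 := by
  have h : 1 / r ^ 12 = (1 / r ^ 6) ^ 2 := by rw [div_pow, ← pow_mul, one_pow]
  unfold VLJ
  rw [h]
  ring

lemma VLJ_antitone {r s : ℝ} (hr : 0 < r) (hrs : r ≤ s) (hs : s ≤ 1) : VLJ s ≤ VLJ r := by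
  have h1 : 1 / s ^ 6 ≤ 1 / r ^ 6 := by gcongr
  have h2 : 1 ≤ 1 / s ^ 6 := by
    have : 0 < s := hr.trans_le hrs
    rw [le_div_iff₀ (by positivity), one_mul]
    exact pow_le_one₀ this.le hs
  rw [VLJ_eq_sq, VLJ_eq_sq]
  nlinarith

lemma neg_one_le_VLJ (r : ℝ) : -1 ≤ VLJ r := by
  rw [VLJ_eq_sq]
  nlinarith [sq_nonneg (1 / r ^ 6 - 1)]

lemma neg_VLJ_le (r : ℝ) : -VLJ r ≤ 2 / r ^ 6 := by
  have h : 0 ≤ 1 / r ^ 12 := one_div_nonneg.mpr (Even.pow_nonneg (by decide) r)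
  unfold VLJ
  linarith

lemma VLJ_nonpos {r : ℝ} (hr : 1 ≤ r) : VLJ r ≤ 0 := by
  have h0 : 0 ≤ 1 / r ^ 6 := by positivity
  have h1 : 1 / r ^ 6 ≤ 1 := by
    rw [div_le_one (by positivity)]
    exact one_le_pow₀ hr
  rw [VLJ_eq_sq]
  nlinarith

/-- The positive zero of the Lennard-Jones potential. -/
lemma zero_VLJ_pow_six : ((2 : ℝ) ^ (-(1 : ℝ) / 6)) ^ 6 = 1 / 2 := by
  rw [← Real.rpow_natCast, ← Real.rpow_mul (by norm_num)]
  norm_num [Real.rpow_neg_one]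

lemma zero_VLJ_lt_one : (2 : ℝ) ^ (-(1 : ℝ) / 6) < 1 :=
  Real.rpow_lt_one_of_one_lt_of_neg (by norm_num) (by norm_num)

lemma VLJ_pos {r : ℝ} (hr : 0 < r) (hr' : r < (2 : ℝ) ^ (-(1 : ℝ) / 6)) : 0 < VLJ r := by
  have h6 : r ^ 6 < 1 / 2 := by
    rw [← zero_VLJ_pow_six]
    gcongr
  have h2 : 2 < 1 / r ^ 6 := by
    rw [lt_div_iff₀ (by positivity)]
    linarith
  rw [VLJ_eq_sq]
  nlinarith

lemma Va_antitone {a r s : ℝ} (ha : 0 < a) (ha' : a ≤ 1) (hrs : r ≤ s) (hs : s ≤ 1) :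
    Va a s ≤ Va a r := by
  rw [Va_eq_VLJ_max, Va_eq_VLJ_max]
  exact VLJ_antitone (lt_max_of_lt_left ha) (max_le_max le_rfl hrs) (max_le ha' hs)

lemma Va_pos {a r : ℝ} (ha : 0 < a) (ha' : a < (2 : ℝ) ^ (-(1 : ℝ) / 6))
    (hr : r < (2 : ℝ) ^ (-(1 : ℝ) / 6)) : 0 < Va a r := by
  rw [Va_eq_VLJ_max]
  exact VLJ_pos (lt_max_of_lt_left ha) (max_lt ha' hr)

/-! ### Removing a particle from a minimum-energy configuration -/

lemma pairEnergy_eq_add (V : ℝ → ℝ) {N : ℕ} (x : Fin N → E3) (i : Fin N) :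
    pairEnergy V x =
      (∑ p : Fin N × Fin N with p.1 < p.2 ∧ p.1 ≠ i ∧ p.2 ≠ i, V ‖x p.1 - x p.2‖) +
        ∑ j with j ≠ i, V ‖x i - x j‖ := by
  unfold pairEnergy
  rw [← Finset.sum_filter_add_sum_filter_not _ (fun p : Fin N × Fin N => p.1 ≠ i ∧ p.2 ≠ i),
    Finset.filter_filter, Finset.filter_filter]
  congr 1
  refine Finset.sum_nbij' (fun p => if p.1 = i then p.2 else p.1)
    (fun j => if i < j then (i, j) else (j, i)) ?_ ?_ ?_ ?_ ?_
  · rintro ⟨p, q⟩ h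
    simp only [Finset.mem_filter, Finset.mem_univ, true_and] at h ⊢
    split_ifs <;> grind
  · intro j h
    simp only [Finset.mem_filter, Finset.mem_univ, true_and] at h ⊢
    split_ifs <;> grind
  · rintro ⟨p, q⟩ h
    simp only [Finset.mem_filter, Finset.mem_univ, true_and] at h ⊢
    grind
  · intro j h
    simp only [Finset.mem_filter, Finset.mem_univ, true_and] at h ⊢
    grind
  · rintro ⟨p, q⟩ h
    simp only [Finset.mem_filter, Finset.mem_univ, true_and] at h ⊢
    split_ifs with hp
    · rw [hp]
    · have hq : q = i := by grind
      rw [hq, norm_sub_rev]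

/-- In a minimum-energy configuration every particle has a nonpositive interaction energy with
the others, provided the potential is nonpositive at large distances. -/
lemma IsMinEnergy.sum_nonpos {V : ℝ → ℝ} {N : ℕ} {x : Fin N → E3} (hx : IsMinEnergy V x)
    (hV : ∀ r, 1 ≤ r → V r ≤ 0) (i : Fin N) : ∑ j with j ≠ i, V ‖x i - x j‖ ≤ 0 := by
  set z : E3 := EuclideanSpace.single 0 (1 + ∑ j, ‖x j‖) with hz
  have hsum : 0 ≤ ∑ j, ‖x j‖ := Finset.sum_nonneg fun _ _ => norm_nonneg _
  have hzn : ‖z‖ = 1 + ∑ j, ‖x j‖ := by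
    rw [hz, PiLp.norm_single, Real.norm_of_nonneg (by positivity)]
  have hfar (j : Fin N) : 1 ≤ ‖z - x j‖ := by
    have h1 := norm_sub_norm_le z (x j)
    have h2 := Finset.single_le_sum (f := fun j => ‖x j‖) (fun _ _ => norm_nonneg _)
      (Finset.mem_univ j)
    linarith
  have h := hx (Function.update x i z)
  rw [pairEnergy_eq_add V x i, pairEnergy_eq_add V (Function.update x i z) i] at h
  have h1 : ∑ p : Fin N × Fin N with p.1 < p.2 ∧ p.1 ≠ i ∧ p.2 ≠ i,
      V ‖Function.update x i z p.1 - Function.update x i z p.2‖ =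
      ∑ p : Fin N × Fin N with p.1 < p.2 ∧ p.1 ≠ i ∧ p.2 ≠ i, V ‖x p.1 - x p.2‖ := by
    refine Finset.sum_congr rfl fun p hp => ?_
    simp only [Finset.mem_filter, Finset.mem_univ, true_and] at hp
    rw [Function.update_of_ne hp.2.1, Function.update_of_ne hp.2.2]
  have h2 : ∑ j with j ≠ i, V ‖Function.update x i z i - Function.update x i z j‖ ≤ 0 := by
    refine Finset.sum_nonpos fun j hj => ?_
    simp only [Finset.mem_filter, Finset.mem_univ, true_and] at hj
    rw [Function.update_self, Function.update_of_ne hj]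
    exact hV _ (hfar j)
  linarith

/-! ### Particles in a single cube -/

/-- Number of coordinates in which two octants of a cube differ. -/
def octantDist (b c : Fin 3 → Bool) : ℕ := (Finset.univ.filter fun t => b t ≠ c t).card

lemma octantDist_le_one_or_of_antipodal :
    ∀ b c d, octantDist b c = 3 → octantDist b d ≤ 1 ∨ octantDist c d ≤ 1 := by
  decide

lemma octantDist_le_one_or_of_adjacent :
    ∀ b c d, octantDist b c = 1 → octantDist b d ≠ 3 → octantDist c d ≠ 3 →
      octantDist b d ≤ 1 ∨ octantDist c d ≤ 1 := by
  decide

lemma octantDist_cases : ∀ b c, octantDist b c = 0 ∨ octantDist b c = 1 ∨ octantDist b c = 2 ∨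
    octantDist b c = 3 := by
  decide

lemma octantDist_self : ∀ b, octantDist b b = 0 := by
  decide

/-- The octants at even distance from a given one are four in number. -/
lemma card_octant_even : ∀ b, (Finset.univ.filter fun c =>
    octantDist b c = 0 ∨ octantDist b c = 2).card = 4 := by
  decide

/-- Either some element has at least half of the family in its own octant or the adjacent ones, or
all octants are at even mutual distance and some octant holds a quarter of the family. -/
lemma exists_octant_concentration {ι : Type*} [DecidableEq ι] (S : Finset ι) (hS : S.Nonempty)
    (b : ι → Fin 3 → Bool) :
    (∃ j ∈ S, S.card ≤ 2 * (S.filter fun k => octantDist (b j) (b k) ≤ 1).card) ∨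
    (∃ j ∈ S, S.card ≤ 4 * (S.filter fun k => octantDist (b j) (b k) = 0).card ∧
      ∀ k ∈ S, octantDist (b j) (b k) ≤ 2) := by
  by_cases hnear : ∃ j ∈ S, S.card ≤ 2 * (S.filter fun k => octantDist (b j) (b k) ≤ 1).card
  · exact Or.inl hnear
  right
  push Not at hnear
  have hcover : ∀ j ∈ S, ∀ k ∈ S,
      ¬ ∀ l ∈ S, octantDist (b j) (b l) ≤ 1 ∨ octantDist (b k) (b l) ≤ 1 := by
    intro j hj k hk h
    have hsub : S ⊆ (S.filter fun l => octantDist (b j) (b l) ≤ 1) ∪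
        (S.filter fun l => octantDist (b k) (b l) ≤ 1) := by
      intro l hl
      rw [← Finset.filter_or, Finset.mem_filter]
      exact ⟨hl, h l hl⟩
    have h1 := (Finset.card_le_card hsub).trans (Finset.card_union_le _ _)
    have h2 := hnear j hj
    have h3 := hnear k hk
    omega
  have hthree : ∀ j ∈ S, ∀ k ∈ S, octantDist (b j) (b k) ≠ 3 := fun j hj k hk h =>
    hcover j hj k hk fun l _ => octantDist_le_one_or_of_antipodal _ _ _ h
  have hone : ∀ j ∈ S, ∀ k ∈ S, octantDist (b j) (b k) ≠ 1 := fun j hj k hk h =>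
    hcover j hj k hk fun l hl => octantDist_le_one_or_of_adjacent _ _ _ h
      (hthree j hj l hl) (hthree k hk l hl)
  have heven : ∀ j ∈ S, ∀ k ∈ S, octantDist (b j) (b k) = 0 ∨ octantDist (b j) (b k) = 2 := by
    intro j hj k hk
    have h1 := hone j hj k hk
    have h3 := hthree j hj k hk
    have h := octantDist_cases (b j) (b k)
    tauto
  obtain ⟨j₀, hj₀⟩ := hS
  obtain ⟨j, hj, hmax⟩ := S.exists_max_image
    (fun j => (S.filter fun k => octantDist (b j) (b k) = 0).card) ⟨j₀, hj₀⟩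
  refine ⟨j, hj, ?_, fun k hk => by rcases heven j hj k hk with h | h <;> omega⟩
  rw [← card_octant_even (b j₀), mul_comm]
  refine Finset.card_le_mul_card_image_of_maps_to (f := b) (fun k hk => ?_) _ fun c _ => ?_
  · simpa using heven j₀ hj₀ k hk
  · rcases (S.filter fun k => b k = c).eq_empty_or_nonempty with h | ⟨k, hk⟩
    · rw [h]
      simp
    · rw [Finset.mem_filter] at hk
      refine le_trans (Finset.card_le_card fun l hl => ?_) (hmax k hk.1)
      rw [Finset.mem_filter] at hl ⊢
      exact ⟨hl.1, by rw [hk.2, hl.2, octantDist_self]⟩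

/-- The octant of a point of the cube with lower corner `c` and side `ℓ`. -/
def octant (ℓ : ℝ) (c y : E3) : Fin 3 → Bool := fun t => decide (ℓ / 2 ≤ y t - c t)

lemma sq_norm_sub_le_octantDist {ℓ : ℝ} {c y z : E3}
    (hy : ∀ t, 0 ≤ y t - c t ∧ y t - c t < ℓ) (hz : ∀ t, 0 ≤ z t - c t ∧ z t - c t < ℓ) :
    ‖y - z‖ ^ 2 ≤ ℓ ^ 2 / 4 * (3 + 3 * octantDist (octant ℓ c y) (octant ℓ c z)) := by
  have hcoord (t : Fin 3) : (y t - z t) ^ 2 ≤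
      ℓ ^ 2 / 4 + ℓ ^ 2 / 4 * (3 * if octant ℓ c y t ≠ octant ℓ c z t then 1 else 0) := by
    obtain ⟨hy0, hy1⟩ := hy t
    obtain ⟨hz0, hz1⟩ := hz t
    split_ifs with h
    · have : |y t - z t| ≤ ℓ := abs_le.mpr ⟨by linarith, by linarith⟩
      nlinarith [sq_le_sq' (abs_le.mp this).1 (abs_le.mp this).2]
    · have : |y t - z t| ≤ ℓ / 2 := by
        simp only [octant, ne_eq, decide_eq_decide, not_not] at h
        by_cases h' : ℓ / 2 ≤ y t - c t
        · have := h.mp h'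
          exact abs_le.mpr ⟨by linarith, by linarith⟩
        · have h'' := mt h.mpr h'
          rw [not_le] at h' h''
          exact abs_le.mpr ⟨by linarith, by linarith⟩
      nlinarith [sq_le_sq' (abs_le.mp this).1 (abs_le.mp this).2]
  rw [EuclideanSpace.real_norm_sq_eq]
  calc ∑ t, (y - z) t ^ 2
      ≤ ∑ t, (ℓ ^ 2 / 4 + ℓ ^ 2 / 4 *
          (3 * if octant ℓ c y t ≠ octant ℓ c z t then (1 : ℝ) else 0)) :=
        Finset.sum_le_sum fun t _ => hcoord t
    _ = _ := by
        rw [Finset.sum_add_distrib, ← Finset.mul_sum, ← Finset.mul_sum, Finset.sum_boole]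
        simp only [octantDist, Finset.sum_const, Finset.card_univ, Fintype.card_fin]
        ring

lemma Va_norm_sub_ge {a ℓ R : ℝ} {c y z : E3} (ha : 0 < a) (ha' : a ≤ 1)
    (hy : ∀ t, 0 ≤ y t - c t ∧ y t - c t < ℓ) (hz : ∀ t, 0 ≤ z t - c t ∧ z t - c t < ℓ)
    {d : ℕ} (hd : octantDist (octant ℓ c y) (octant ℓ c z) ≤ d)
    (hR0 : 0 ≤ R) (hR : ℓ ^ 2 / 4 * (3 + 3 * d) ≤ R ^ 2) (hR1 : R ≤ 1) :
    Va a R ≤ Va a ‖y - z‖ := by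
  refine Va_antitone ha ha' (abs_le_of_sq_le_sq' ?_ hR0).2 hR1
  refine (sq_norm_sub_le_octantDist hy hz).trans (le_trans ?_ hR)
  gcongr

/-- A sum of terms each at least `u` on a subset containing `j` and at least `v` elsewhere. -/
lemma le_sum_erase_of_le {ι : Type*} [DecidableEq ι] (S : Finset ι) (P : ι → Prop)
    [DecidablePred P] {j : ι} (hj : j ∈ S) (hPj : P j) (f : ι → ℝ) (u v : ℝ)
    (hu : ∀ k ∈ S, P k → u ≤ f k) (hv : ∀ k ∈ S, v ≤ f k) :
    u * ((S.filter P).card - 1) + v * (S.card - (S.filter P).card) ≤ ∑ k ∈ S.erase j, f k := by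
  have h1 : ∑ k ∈ S, (if P k then u else v) =
      u * (S.filter P).card + v * (S.card - (S.filter P).card) := by
    rw [Finset.sum_ite, Finset.sum_const, Finset.sum_const, nsmul_eq_mul, nsmul_eq_mul,
      ← Finset.card_filter_add_card_filter_not (s := S) P]
    push_cast
    ring
  have h2 : ∑ k ∈ S.erase j, (if P k then u else v) ≤ ∑ k ∈ S.erase j, f k := by
    refine Finset.sum_le_sum fun k hk => ?_
    have hk' := Finset.mem_of_mem_erase hk
    split_ifs with h
    · exact hu k hk' h
    · exact hv k hk'
  have h3 := Finset.add_sum_erase S (fun k => if P k then u else v) hj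
  simp only [if_pos hPj] at h3
  linarith

/-- If every particle has positive interaction at most `W`, the number of particles in a cube of
side `ℓ` is bounded. -/
lemma card_cube_le {ℓ a W : ℝ} (hℓ : 0 < ℓ) (hℓ' : √3 * ℓ < (2 : ℝ) ^ (-(1 : ℝ) / 6))
    (ha : 0 < a) (ha' : a ≤ √3 / 2 * ℓ) {N : ℕ} (x : Fin N → E3)
    (hW : ∀ i, Wplus a x i ≤ W) (c : E3) (S : Finset (Fin N)) (hSne : S.Nonempty)
    (hS : ∀ j ∈ S, ∀ t, 0 ≤ x j t - c t ∧ x j t - c t < ℓ) :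
    (S.card : ℝ) * ((Va a (√6 / 2 * ℓ) + Va a (√3 * ℓ)) / 2) ≤ W + Va a (√6 / 2 * ℓ) ∨
    (S.card : ℝ) * ((Va a (√3 / 2 * ℓ) + 3 * Va a (3 / 2 * ℓ)) / 4) ≤
      W + Va a (√3 / 2 * ℓ) := by
  have h3 : √3 ^ 2 = 3 := Real.sq_sqrt (by norm_num)
  have h6 : √6 ^ 2 = 6 := Real.sq_sqrt (by norm_num)
  have h30 : 0 ≤ √3 := Real.sqrt_nonneg 3
  have h60 : 0 ≤ √6 := Real.sqrt_nonneg 6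
  have hr1 := zero_VLJ_lt_one
  have hs3 : √3 * ℓ ≤ 1 := (hℓ'.trans hr1).le
  have hs6' : √6 / 2 ≤ √3 := by nlinarith
  have hs6 : √6 / 2 * ℓ ≤ √3 * ℓ := by gcongr
  have h32' : (3 / 2 : ℝ) ≤ √3 := by nlinarith
  have h32 : 3 / 2 * ℓ ≤ √3 * ℓ := by gcongr
  have h3h : √3 / 2 * ℓ ≤ √3 * ℓ := by nlinarith [mul_nonneg h30 hℓ.le]
  have h3h' : √3 / 2 * ℓ ≤ 3 / 2 * ℓ := by
    have : √3 / 2 ≤ 3 / 2 := by nlinarith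
    gcongr
  have ha1 : a ≤ 1 := by linarith
  have ha0 : a < (2 : ℝ) ^ (-(1 : ℝ) / 6) := by linarith
  have hdist (d : ℕ) (R : ℝ) (hR0 : 0 ≤ R) (hR : ℓ ^ 2 / 4 * (3 + 3 * d) ≤ R ^ 2) (hR1 : R ≤ 1)
      (j : Fin N) (hj : j ∈ S) (k : Fin N) (hk : k ∈ S)
      (hd : octantDist (octant ℓ c (x j)) (octant ℓ c (x k)) ≤ d) :
      Va a R ≤ Va a ‖x j - x k‖ :=
    Va_norm_sub_ge ha ha1 (hS j hj) (hS k hk) hd hR0 hR hR1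
  have hle3 (j k : Fin N) : octantDist (octant ℓ c (x j)) (octant ℓ c (x k)) ≤ 3 := by
    rcases octantDist_cases (octant ℓ c (x j)) (octant ℓ c (x k)) with h | h | h | h <;> omega
  have hWS (j : Fin N) (hj : j ∈ S) : ∑ k ∈ S.erase j, Va a ‖x j - x k‖ ≤ W := by
    refine le_trans ?_ (hW j)
    unfold Wplus
    refine Finset.sum_le_sum_of_subset_of_nonneg (fun k hk => ?_) fun k hk _ => ?_
    · rw [Finset.mem_erase] at hk
      simp only [Finset.mem_filter, Finset.mem_univ, true_and]
      refine ⟨hk.1, lt_of_le_of_lt ?_ hℓ'⟩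
      have h := sq_norm_sub_le_octantDist (hS j hj) (hS k hk.2)
      have h3' : (octantDist (octant ℓ c (x j)) (octant ℓ c (x k)) : ℝ) ≤ 3 := by
        exact_mod_cast hle3 j k
      refine (abs_le_of_sq_le_sq' ?_ (by positivity)).2
      rw [mul_pow, h3]
      nlinarith [sq_nonneg ℓ]
    · simp only [Finset.mem_filter, Finset.mem_univ, true_and] at hk
      exact (Va_pos ha ha0 hk.2).le
  rcases exists_octant_concentration S hSne (fun j => octant ℓ c (x j)) with
    ⟨j, hj, hcard⟩ | ⟨j, hj, hcard, htwo⟩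
  · left
    have hcard' : (S.card : ℝ) ≤ 2 * ((S.filter fun k =>
        octantDist (octant ℓ c (x j)) (octant ℓ c (x k)) ≤ 1).card : ℝ) := by
      exact_mod_cast hcard
    have h := le_sum_erase_of_le S
      (fun k => octantDist (octant ℓ c (x j)) (octant ℓ c (x k)) ≤ 1) hj
      (by rw [octantDist_self]; omega) (fun k => Va a ‖x j - x k‖)
      (Va a (√6 / 2 * ℓ)) (Va a (√3 * ℓ))
      (fun k hk hd => hdist 1 _ (by positivity)
        (by rw [mul_pow, div_pow, h6]; push_cast; nlinarith) (hs6.trans hs3) j hj k hk hd)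
      (fun k hk => hdist 3 _ (by positivity)
        (by rw [mul_pow, h3]; push_cast; nlinarith) hs3 j hj k hk (hle3 j k))
    have hmono : Va a (√3 * ℓ) ≤ Va a (√6 / 2 * ℓ) := Va_antitone ha ha1 hs6 hs3
    have := hWS j hj
    nlinarith [mul_nonneg (sub_nonneg.mpr hcard') (sub_nonneg.mpr hmono)]
  · right
    have hcard' : (S.card : ℝ) ≤ 4 * ((S.filter fun k =>
        octantDist (octant ℓ c (x j)) (octant ℓ c (x k)) = 0).card : ℝ) := by
      exact_mod_cast hcard
    have h := le_sum_erase_of_le S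
      (fun k => octantDist (octant ℓ c (x j)) (octant ℓ c (x k)) = 0) hj
      (octantDist_self _) (fun k => Va a ‖x j - x k‖)
      (Va a (√3 / 2 * ℓ)) (Va a (3 / 2 * ℓ))
      (fun k hk hd => hdist 0 _ (by positivity)
        (by rw [mul_pow, div_pow, h3]; push_cast; nlinarith) (h3h.trans hs3) j hj k hk hd.le)
      (fun k hk => hdist 2 _ (by positivity)
        (by rw [mul_pow]; push_cast; nlinarith) (h32.trans hs3) j hj k hk (htwo k hk))
    have hmono : Va a (3 / 2 * ℓ) ≤ Va a (√3 / 2 * ℓ) := Va_antitone ha ha1 h3h' (h32.trans hs3)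
    have := hWS j hj
    nlinarith [mul_nonneg (sub_nonneg.mpr hcard') (sub_nonneg.mpr hmono)]

/-! ### Dyadic covering -/

/-- If every half-open cube of side `ℓ` holds at most `n` particles, then a ball of radius
`2 * m` holds at most `(m * ⌈4 / ℓ⌉) ^ 3 * n` particles. -/
lemma card_ball_le {ℓ n : ℝ} (hℓ : 0 < ℓ) {N : ℕ} (x : Fin N → E3)
    (hcube : ∀ (c : E3) (S : Finset (Fin N)),
      (∀ j ∈ S, ∀ t, 0 ≤ x j t - c t ∧ x j t - c t < ℓ) → (S.card : ℝ) ≤ n)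
    (z : E3) (m : ℕ) :
    ((Finset.univ.filter fun j => ‖z - x j‖ < 2 * m).card : ℝ) ≤ (m * ⌈4 / ℓ⌉) ^ 3 * n := by
  have hL : (0 : ℤ) ≤ ⌈4 / ℓ⌉ := Int.ceil_nonneg (by positivity)
  set K : Finset (Fin 3 → ℤ) := Fintype.piFinset fun _ => Finset.Ico 0 (m * ⌈4 / ℓ⌉) with hK
  have hKcard : (K.card : ℝ) = (m * ⌈4 / ℓ⌉) ^ 3 := by
    have : (K.card : ℤ) = (m * ⌈4 / ℓ⌉) ^ 3 := by
      rw [hK, Fintype.card_piFinset_const, Int.card_Ico, sub_zero]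
      push_cast
      rw [Int.toNat_of_nonneg (by positivity)]
    exact_mod_cast this
  set f : Fin N → Fin 3 → ℤ := fun j t => ⌊(x j t - z t + 2 * m) / ℓ⌋ with hf
  have hmaps : ∀ j ∈ Finset.univ.filter fun j => ‖z - x j‖ < 2 * m, f j ∈ K := by
    intro j hj
    simp only [Finset.mem_filter, Finset.mem_univ, true_and] at hj
    rw [hK, Fintype.mem_piFinset]
    intro t
    have ht : |z t - x j t| < 2 * m := lt_of_le_of_lt (PiLp.norm_apply_le (z - x j) t) hj
    rw [abs_lt] at ht
    rw [Finset.mem_Ico, hf]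
    refine ⟨Int.floor_nonneg.mpr (div_nonneg (by linarith) hℓ.le), Int.floor_lt.mpr ?_⟩
    push_cast
    calc (x j t - z t + 2 * m) / ℓ < (4 * m) / ℓ := by gcongr; linarith
      _ = m * (4 / ℓ) := by ring
      _ ≤ m * ⌈4 / ℓ⌉ := by gcongr; exact Int.le_ceil _
  rw [Finset.card_eq_sum_card_fiberwise hmaps, ← hKcard]
  push_cast
  rw [← nsmul_eq_mul]
  refine Finset.sum_le_card_nsmul _ _ _ fun k _ => ?_
  refine hcube (WithLp.toLp 2 fun t => z t - 2 * m + k t * ℓ) _ fun j hj t => ?_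
  rw [Finset.mem_filter] at hj
  have hjk : ⌊(x j t - z t + 2 * m) / ℓ⌋ = k t := congrFun hj.2 t
  rw [Int.floor_eq_iff, le_div_iff₀ hℓ, div_lt_iff₀ hℓ] at hjk
  simp only
  constructor <;> linarith

lemma neg_VLJ_le_dyadic_sum (r : ℝ) (M : ℕ) (hr : r < 2 * (2 : ℝ) ^ M) :
    -VLJ r ≤ (if r < 2 then 1 else 0) +
      ∑ k ∈ Finset.range M, 2 / 64 ^ (k + 1) * (if r < 2 * (2 : ℝ) ^ (k + 1) then 1 else 0) := by
  induction M with
  | zero =>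
    rw [pow_zero, mul_one] at hr
    rw [if_pos hr]
    simpa using neg_le.mp (neg_one_le_VLJ r)
  | succ M ih =>
    rw [Finset.sum_range_succ, if_pos hr, mul_one]
    by_cases h : r < 2 * (2 : ℝ) ^ M
    · have := ih h
      have : (0 : ℝ) ≤ 2 / 64 ^ (M + 1) := by positivity
      linarith
    · have h1 : (0 : ℝ) ≤ (if r < 2 then 1 else 0) +
          ∑ k ∈ Finset.range M,
            2 / 64 ^ (k + 1) * (if r < 2 * (2 : ℝ) ^ (k + 1) then 1 else 0) := by
        positivity
      have h2 : (2 : ℝ) / r ^ 6 ≤ 2 / 64 ^ (M + 1) := by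
        have : (64 : ℝ) ^ (M + 1) = (2 * 2 ^ M) ^ 6 := by
          rw [← pow_succ', ← pow_mul, mul_comm, pow_mul]
          norm_num
        rw [this]
        have := not_lt.mp h
        gcongr
      have := neg_VLJ_le r
      linarith

lemma sum_two_div_eight_pow_le (M : ℕ) :
    ∑ k ∈ Finset.range M, (2 : ℝ) / 64 ^ (k + 1) * (2 ^ (k + 1)) ^ 3 ≤ 2 / 7 := by
  have h : ∑ k ∈ Finset.range M, (2 : ℝ) / 64 ^ (k + 1) * (2 ^ (k + 1)) ^ 3 =
      2 / 7 - 2 / 7 / 8 ^ M := by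
    induction M with
    | zero => simp
    | succ M ih =>
      rw [Finset.sum_range_succ, ih]
      have : (64 : ℝ) ^ (M + 1) = 8 ^ (M + 1) * 8 ^ (M + 1) := by rw [← mul_pow]; norm_num
      have h8 : ((2 : ℝ) ^ (M + 1)) ^ 3 = 8 ^ (M + 1) := by
        rw [← pow_mul, mul_comm, pow_mul]
        norm_num
      rw [this, h8]
      field_simp
      ring
  rw [h]
  have : (0 : ℝ) ≤ 2 / 7 / 8 ^ M := by positivity
  linarith

/-- A bound on the total attraction felt at a point when every cube of side `ℓ` holds at most `n`
particles. -/
lemma sum_neg_VLJ_le {ℓ n : ℝ} (hℓ : 0 < ℓ) {N : ℕ} (x : Fin N → E3)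
    (hcube : ∀ (c : E3) (S : Finset (Fin N)),
      (∀ j ∈ S, ∀ t, 0 ≤ x j t - c t ∧ x j t - c t < ℓ) → (S.card : ℝ) ≤ n)
    (z : E3) (T : Finset (Fin N)) :
    ∑ j ∈ T, -VLJ ‖z - x j‖ ≤ 9 / 7 * ((⌈4 / ℓ⌉ : ℝ) ^ 3 * n) := by
  obtain ⟨M, hM⟩ : ∃ M : ℕ, ∀ j, ‖z - x j‖ < 2 * (2 : ℝ) ^ M := by
    obtain ⟨M, hM⟩ := pow_unbounded_of_one_lt (∑ j, ‖z - x j‖) (one_lt_two (α := ℝ))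
    refine ⟨M, fun j => ?_⟩
    have := Finset.single_le_sum (f := fun j => ‖z - x j‖) (fun _ _ => norm_nonneg _)
      (Finset.mem_univ j)
    have h2 : (0 : ℝ) < 2 ^ M := by positivity
    linarith
  have hn : 0 ≤ n := by simpa using hcube 0 ∅ (by simp)
  have hL : (0 : ℝ) ≤ ⌈4 / ℓ⌉ := by exact_mod_cast Int.ceil_nonneg (by positivity : 0 ≤ 4 / ℓ)
  have hB : 0 ≤ (⌈4 / ℓ⌉ : ℝ) ^ 3 * n := by positivity
  have hball (k : ℕ) : ∑ j, (if ‖z - x j‖ < 2 * (2 : ℝ) ^ k then (1 : ℝ) else 0) ≤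
      (2 ^ k) ^ 3 * ((⌈4 / ℓ⌉ : ℝ) ^ 3 * n) := by
    rw [Finset.sum_boole]
    have := card_ball_le hℓ x hcube z (2 ^ k)
    push_cast at this
    rwa [mul_pow, mul_assoc] at this
  have hball0 : ∑ j, (if ‖z - x j‖ < 2 then (1 : ℝ) else 0) ≤ (⌈4 / ℓ⌉ : ℝ) ^ 3 * n := by
    simpa using hball 0
  calc ∑ j ∈ T, -VLJ ‖z - x j‖
      ≤ ∑ j ∈ T, ((if ‖z - x j‖ < 2 then 1 else 0) + ∑ k ∈ Finset.range M,
          2 / 64 ^ (k + 1) * (if ‖z - x j‖ < 2 * (2 : ℝ) ^ (k + 1) then 1 else 0)) :=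
        Finset.sum_le_sum fun j _ => neg_VLJ_le_dyadic_sum _ M (hM j)
    _ ≤ ∑ j, ((if ‖z - x j‖ < 2 then 1 else 0) + ∑ k ∈ Finset.range M,
          2 / 64 ^ (k + 1) * (if ‖z - x j‖ < 2 * (2 : ℝ) ^ (k + 1) then 1 else 0)) :=
        Finset.sum_le_sum_of_subset_of_nonneg (Finset.subset_univ T) fun j _ _ => by positivity
    _ = ∑ j, (if ‖z - x j‖ < 2 then (1 : ℝ) else 0) + ∑ k ∈ Finset.range M,
          2 / 64 ^ (k + 1) * ∑ j, (if ‖z - x j‖ < 2 * (2 : ℝ) ^ (k + 1) then 1 else 0) := by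
        rw [Finset.sum_add_distrib, Finset.sum_comm]
        simp only [Finset.mul_sum]
    _ ≤ (⌈4 / ℓ⌉ : ℝ) ^ 3 * n + ∑ k ∈ Finset.range M,
          2 / 64 ^ (k + 1) * ((2 ^ (k + 1)) ^ 3 * ((⌈4 / ℓ⌉ : ℝ) ^ 3 * n)) := by
        gcongr
        exact hball _
    _ = (⌈4 / ℓ⌉ : ℝ) ^ 3 * n + (∑ k ∈ Finset.range M,
          (2 : ℝ) / 64 ^ (k + 1) * (2 ^ (k + 1)) ^ 3) * ((⌈4 / ℓ⌉ : ℝ) ^ 3 * n) := by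
        rw [Finset.sum_mul]
        simp only [mul_assoc]
    _ ≤ (⌈4 / ℓ⌉ : ℝ) ^ 3 * n + 2 / 7 * ((⌈4 / ℓ⌉ : ℝ) ^ 3 * n) := by
        gcongr
        exact sum_two_div_eight_pow_le M
    _ = _ := by ring

/-- In a minimum-energy configuration the repulsion felt by a particle is at most the attraction
it feels. -/
lemma IsMinEnergy.Wplus_le {a : ℝ} (ha' : a < (2 : ℝ) ^ (-(1 : ℝ) / 6)) {N : ℕ}
    {x : Fin N → E3} (hx : IsMinEnergy (Va a) x) (i : Fin N) :
    Wplus a x i ≤ ∑ j with j ≠ i ∧ ¬ ‖x i - x j‖ < (2 : ℝ) ^ (-(1 : ℝ) / 6),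
      -VLJ ‖x i - x j‖ := by
  have h1 := hx.sum_nonpos (fun r hr => by
    rw [Va_eq_VLJ_max]
    exact VLJ_nonpos (le_max_of_le_right hr)) i
  rw [← Finset.sum_filter_add_sum_filter_not _
    (fun j => ‖x i - x j‖ < (2 : ℝ) ^ (-(1 : ℝ) / 6)),
    Finset.filter_filter, Finset.filter_filter] at h1
  have h2 : ∑ j with j ≠ i ∧ ¬ ‖x i - x j‖ < (2 : ℝ) ^ (-(1 : ℝ) / 6), Va a ‖x i - x j‖ =
      ∑ j with j ≠ i ∧ ¬ ‖x i - x j‖ < (2 : ℝ) ^ (-(1 : ℝ) / 6), VLJ ‖x i - x j‖ := by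
    refine Finset.sum_congr rfl fun j hj => ?_
    simp only [Finset.mem_filter, Finset.mem_univ, true_and, not_lt] at hj
    rw [Va_eq_VLJ_max, max_eq_right (ha'.le.trans hj.2)]
  rw [h2] at h1
  rw [Finset.sum_neg_distrib]
  unfold Wplus
  linarith

lemma le_div_of_self_consistent {W Ω n c v D : ℝ} (hΩ : 0 < Ω) (hD : 0 < D)
    (hDc : D = (23 / 32) / Ω * c - 1) (hn : n * c ≤ W + v) (hW : W ≤ 32 / 23 * (Ω * n)) :
    W ≤ v / D := by
  have h1 : (D + 1) * W ≤ W + v := by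
    calc (D + 1) * W ≤ (D + 1) * (32 / 23 * (Ω * n)) := by gcongr
      _ = n * c := by rw [hDc]; field_simp; ring
      _ ≤ W + v := hn
  rw [le_div_iff₀ hD]
  linarith

/-- bound on the maximal positive interaction `W⁺_a(x*)` in any
minimum-energy configuration, in terms of the grid size `ℓ`. -/
theorem stmt13 (ℓ : ℝ) (hℓ : 0 < ℓ) (hℓ' : Real.sqrt 3 * ℓ < (2 : ℝ) ^ (-(1 : ℝ) / 6))
    (a : ℝ) (ha : 0 < a) (ha' : a ≤ Real.sqrt 3 / 2 * ℓ)
    (Ω D₁ D₂ : ℝ)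
    (hΩ : Ω = ((⌈(4 : ℝ) / ℓ⌉ : ℝ) + 1) ^ 3)
    (hD₁ : D₁ = (23 / 32) / (2 * Ω) *
      (Va a (Real.sqrt 6 / 2 * ℓ) + Va a (Real.sqrt 3 * ℓ)) - 1)
    (hD₂ : D₂ = (23 / 32) / (4 * Ω) *
      (Va a (Real.sqrt 3 / 2 * ℓ) + 3 * Va a (3 / 2 * ℓ)) - 1)
    (hD₁pos : 0 < D₁) (hD₂pos : 0 < D₂)
    (N : ℕ) (hN : 2 ≤ N) (x : Fin N → E3) (hx : IsMinEnergy (Va a) x) :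
    WplusMax a x ≤
      max (Va a (Real.sqrt 6 / 2 * ℓ) / D₁) (Va a (Real.sqrt 3 / 2 * ℓ) / D₂) := by
  have : Nonempty (Fin N) := ⟨⟨0, by omega⟩⟩
  obtain ⟨i, hi⟩ := Finite.exists_max (Wplus a x)
  refine (csSup_le ⟨_, i, rfl⟩ (by rintro _ ⟨j, rfl⟩; exact hi j) :
    WplusMax a x ≤ Wplus a x i).trans ?_
  have hpos : 0 < √3 * ℓ := by positivity
  have ha0 : a < (2 : ℝ) ^ (-(1 : ℝ) / 6) := by linarith
  have hL : (0 : ℝ) ≤ ⌈4 / ℓ⌉ := by exact_mod_cast Int.ceil_nonneg (by positivity : 0 ≤ 4 / ℓ)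
  have hΩpos : 0 < Ω := by rw [hΩ]; positivity
  have hc₁ : D₁ = (23 / 32) / Ω * ((Va a (√6 / 2 * ℓ) + Va a (√3 * ℓ)) / 2) - 1 := by
    rw [hD₁]; field_simp
  have hc₂ : D₂ = (23 / 32) / Ω * ((Va a (√3 / 2 * ℓ) + 3 * Va a (3 / 2 * ℓ)) / 4) - 1 := by
    rw [hD₂]; field_simp
  -- the most populated cube of side `ℓ`
  obtain ⟨S, ⟨c, hSc⟩, hSmax⟩ := Set.exists_max_image
    {S : Finset (Fin N) | ∃ c : E3, ∀ j ∈ S, ∀ t, 0 ≤ x j t - c t ∧ x j t - c t < ℓ}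
    Finset.card (Set.toFinite _) ⟨{i}, x i, by simpa using hℓ⟩
  have hSne : S.Nonempty := by
    have := hSmax {i} ⟨x i, by simpa using hℓ⟩
    rw [Finset.card_singleton] at this
    exact Finset.card_pos.mp this
  have hcube : ∀ (c : E3) (T : Finset (Fin N)),
      (∀ j ∈ T, ∀ t, 0 ≤ x j t - c t ∧ x j t - c t < ℓ) → (T.card : ℝ) ≤ S.card :=
    fun c T hT => by exact_mod_cast hSmax T ⟨c, hT⟩
  have hW : Wplus a x i ≤ 32 / 23 * (Ω * S.card) := by
    refine (hx.Wplus_le ha0 i).trans ((sum_neg_VLJ_le hℓ x hcube (x i) _).trans ?_)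
    rw [hΩ]
    gcongr ?_ * (?_ ^ 3 * _)
    · norm_num
    · linarith
  rcases card_cube_le hℓ hℓ' ha ha' x hi c S hSne hSc with h | h
  · exact le_max_of_le_left (le_div_of_self_consistent hΩpos hD₁pos hc₁ h hW)
  · exact le_max_of_le_right (le_div_of_self_consistent hΩpos hD₂pos hc₂ h hW)

end
end

section
/- Let V be a measurable pair potential on (0,∞) that is stable with constant B ≥ 0 and tempered. Then for every β > 0, the integral C(β) = ∫_{ℝ³} |e^{−βV(|x|)} − 1| dx is finite. -/
open MeasureTheory Real

noncomputable section

theorem IsStableWith.neg_two_mul_le {V : ℝ → ℝ} {B : ℝ} (hB : IsStableWith V B) (x : E3) :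
    -(2 * B) ≤ V ‖x‖ := by
  have h := hB.2 2 ![x, 0]
  have hs : (Finset.univ.filter fun p : Fin 2 × Fin 2 => p.1 < p.2) = {(0, 1)} := by decide
  rw [pairEnergy, hs, Finset.sum_singleton] at h
  simp only [Matrix.cons_val_zero, Matrix.cons_val_one, sub_zero, Nat.cast_ofNat] at h
  linarith

theorem abs_exp_sub_one_le_of_le {t M : ℝ} (hM : 0 ≤ M) (ht : t ≤ M) :
    |Real.exp t - 1| ≤ Real.exp M * |t| := by
  have h1 := Real.add_one_le_exp t
  have hexp : 1 ≤ Real.exp M := Real.one_le_exp hM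
  rcases le_total 0 t with h | h
  · have h2 := Real.add_one_le_exp (-t)
    have h3 : Real.exp t * Real.exp (-t) = 1 := by rw [← Real.exp_add]; simp
    have h4 : Real.exp t ≤ Real.exp M := Real.exp_le_exp.2 ht
    rw [abs_of_nonneg h, abs_of_nonneg (by linarith)]
    nlinarith [Real.exp_pos t]
  · have h2 : Real.exp t ≤ 1 := Real.exp_le_one_iff.2 h
    rw [abs_of_nonpos h, abs_of_nonpos (by linarith)]
    nlinarith

/-- for a stable and tempered pair potential,
`C(β) = ∫_{ℝ³} |e^{-βV(|x|)} - 1| dx` is finite. -/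
theorem stmt15 (V : ℝ → ℝ) (hV : Measurable V) (B : ℝ) (hB : IsStableWith V B)
    (hT : IsTempered V) (β : ℝ) (hβ : 0 < β) :
    Integrable (fun x : E3 => |Real.exp (-β * V ‖x‖) - 1|) := by
  obtain ⟨r₀, -, hint⟩ := hT
  have hM : 0 ≤ β * (2 * B) := mul_nonneg hβ.le (mul_nonneg zero_le_two hB.1)
  have hle (x : E3) : -β * V ‖x‖ ≤ β * (2 * B) := by
    nlinarith [hB.neg_two_mul_le x]
  have hmeas : Measurable fun x : E3 => |Real.exp (-β * V ‖x‖) - 1| := by fun_prop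
  have hset : MeasurableSet {x : E3 | r₀ ≤ ‖x‖} := measurableSet_le measurable_const measurable_norm
  rw [← integrableOn_univ, ← Set.union_compl_self {x : E3 | r₀ ≤ ‖x‖}]
  refine IntegrableOn.union ?_ ?_
  · refine Integrable.mono' (hint.const_mul (Real.exp (β * (2 * B)) * β))
      hmeas.aestronglyMeasurable (Filter.Eventually.of_forall fun x => ?_)
    rw [Real.norm_eq_abs, abs_abs]
    refine (abs_exp_sub_one_le_of_le hM (hle x)).trans_eq ?_
    rw [abs_mul, abs_neg, abs_of_pos hβ, mul_assoc]
  · have hball : {x : E3 | r₀ ≤ ‖x‖}ᶜ = Metric.ball 0 r₀ := by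
      ext x
      simp
    rw [hball]
    refine Measure.integrableOn_of_bounded (M := Real.exp (β * (2 * B)))
      measure_ball_lt_top.ne hmeas.aestronglyMeasurable
      (Filter.Eventually.of_forall fun x => ?_)
    rw [Real.norm_eq_abs, abs_abs, abs_le]
    have h1 := Real.exp_le_exp.2 (hle x)
    have h2 := Real.one_le_exp hM
    have h3 := Real.exp_pos (-β * V ‖x‖)
    constructor <;> linarith

end
end
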